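/- arXiv:1305.5403 — 2 statements merged into one kernel-verified Lean document; each statement's English description precedes it below -/
import Mathlib

section
/- Suppose G is a finitely generated group and N is a centerless normal subgroup of finite index in G. Then the finite index subgroup Out_0(G) of Out(G), consisting of classes of automorphisms that preserve N and act trivially on G/N, is isomorphic to a quotient of a subgroup of Out(N) by a finite normal subgroup. Consequently, if Out(N) is residually finite then Out(G) is residually finite. -/
/-- A group is residually finite if every nontrivial element has nontrivial image
in some finite quotient. -/
def ResiduallyFinite (G : Type*) [Group G] : Prop :=
  ∀ g : G, g ≠ 1 → ∃ (K : Type) (_ : Group K) (_ : Finite K) (φ : G →* K), φ g ≠ 1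

/-- The subgroup of inner automorphisms is normal in the automorphism group. -/
instance innNormal (G : Type*) [Group G] : (MulAut.conj : G →* MulAut G).range.Normal := by
  constructor
  intro n hn α
  obtain ⟨g, rfl⟩ := hn
  refine ⟨α g, ?_⟩
  ext x
  show MulAut.conj (α g) x = α (MulAut.conj g (α⁻¹ x))
  simp [MulAut.conj_apply, map_mul, map_inv, MulAut.apply_inv_self]

/-- The outer automorphism group `Out(G) = Aut(G)/Inn(G)`. -/
abbrev Out (G : Type*) [Group G] := MulAut G ⧸ (MulAut.conj : G →* MulAut G).range

theorem residuallyFinite_iff {G : Type*} [Group G] :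
    ResiduallyFinite G ↔ ∀ g : G, g ≠ 1 →
      ∃ H : Subgroup G, H.Normal ∧ H.FiniteIndex ∧ g ∉ H := by
  refine forall₂_congr fun g _ ↦ ⟨?_, ?_⟩
  · rintro ⟨K, _, _, φ, hφ⟩
    exact ⟨φ.ker, inferInstance, inferInstance, hφ⟩
  · rintro ⟨H, _, _, hg⟩
    let e : Shrink.{0} (G ⧸ H) ≃* G ⧸ H := Shrink.mulEquiv
    refine ⟨Shrink.{0} (G ⧸ H), inferInstance, Finite.of_equiv _ e.symm.toEquiv,
      e.symm.toMonoidHom.comp (QuotientGroup.mk' H), fun h ↦ hg ?_⟩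
    rw [← QuotientGroup.eq_one_iff]
    exact e.symm.map_eq_one_iff.mp h

theorem ResiduallyFinite.of_injective {G H : Type*} [Group G] [Group H] (φ : G →* H)
    (hφ : Function.Injective φ) (h : ResiduallyFinite H) : ResiduallyFinite G := by
  intro g hg
  obtain ⟨K, hK, hfin, ψ, hψ⟩ := h (φ g) ((map_ne_one_iff φ hφ).mpr hg)
  exact ⟨K, hK, hfin, ψ.comp φ, hψ⟩

theorem ResiduallyFinite.quotient {G : Type*} [Group G] (h : ResiduallyFinite G)
    (F : Subgroup G) [F.Normal] [Finite F] : ResiduallyFinite (G ⧸ F) := by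
  rw [residuallyFinite_iff] at h ⊢
  intro x hx
  obtain ⟨g, rfl⟩ := QuotientGroup.mk_surjective x
  have hg : g ∉ F := fun hg ↦ hx ((QuotientGroup.eq_one_iff g).mpr hg)
  have hne (f : F) : g * (f : G)⁻¹ ≠ 1 := fun hf ↦ hg (mul_inv_eq_one.mp hf ▸ f.2)
  choose H hN hfin hmem using fun f : F ↦ h _ (hne f)
  have hnormal : (⨅ f, H f).Normal := Subgroup.normal_iInf_normal hN
  have : (⨅ f, H f).FiniteIndex := Subgroup.finiteIndex_iInf hfin
  have hsurj := QuotientGroup.mk'_surjective F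
  refine ⟨(⨅ f, H f).map (QuotientGroup.mk' F), hnormal.map _ hsurj, ⟨?_⟩, ?_⟩
  · exact ne_zero_of_dvd_ne_zero this.index_ne_zero (Subgroup.index_map_dvd _ hsurj)
  · rintro ⟨a, ha, hag⟩
    have hf : a⁻¹ * g ∈ F := QuotientGroup.eq.mp hag
    refine hmem ⟨_, hf⟩ ?_
    simpa using Subgroup.mem_iInf.mp ha ⟨_, hf⟩

theorem ResiduallyFinite.of_finiteIndex {G : Type*} [Group G] (K : Subgroup G) [K.FiniteIndex]
    (h : ResiduallyFinite K) : ResiduallyFinite G := by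
  rw [residuallyFinite_iff] at h ⊢
  intro g hg
  suffices ∃ H : Subgroup G, H.FiniteIndex ∧ g ∉ H by
    obtain ⟨H, _, hgH⟩ := this
    exact ⟨H.normalCore, inferInstance, inferInstance, fun h ↦ hgH (H.normalCore_le h)⟩
  by_cases hgK : g ∈ K
  · obtain ⟨H, _, hH, hgH⟩ := h ⟨g, hgK⟩ (by simpa [Subtype.ext_iff] using hg)
    refine ⟨H.map K.subtype, ⟨?_⟩, ?_⟩
    · rw [Subgroup.index_map_subtype]
      exact mul_ne_zero hH.index_ne_zero Subgroup.FiniteIndex.index_ne_zero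
    · rintro ⟨x, hx, hxg⟩
      exact hgH ((Subtype.ext hxg : x = ⟨g, hgK⟩) ▸ hx)
  · exact ⟨K, inferInstance, hgK⟩

theorem Group.FG.finite_monoidHom {G K : Type*} [Group G] [Group K] [Finite K]
    (hG : Group.FG G) : Finite (G →* K) := by
  obtain ⟨S, hS⟩ := hG.out
  refine Finite.of_injective (fun (φ : G →* K) (s : S) ↦ φ s) fun φ ψ h ↦ ?_
  exact MonoidHom.eq_of_eqOn_dense hS fun s hs ↦ congrFun h ⟨s, hs⟩

section TrivialOnQuotient

variable {G : Type*} [Group G] (N : Subgroup G)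

/-- The automorphisms of `G` that preserve every left coset of `N`. -/
def autTrivialOnQuotient : Subgroup (MulAut G) where
  carrier := {α | ∀ g : G, g⁻¹ * α g ∈ N}
  one_mem' g := by simp
  mul_mem' {α β} hα hβ g := by
    simpa [mul_assoc] using N.mul_mem (hβ g) (hα (β g))
  inv_mem' {α} hα g := by
    simpa using N.inv_mem (hα (α⁻¹ g))

variable {N}

theorem map_mem_of_mem_autTrivialOnQuotient {α : MulAut G} (hα : α ∈ autTrivialOnQuotient N)
    {n : G} (hn : n ∈ N) : α n ∈ N := by
  simpa using N.mul_mem hn (hα n)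

theorem conj_mem_autTrivialOnQuotient [hN : N.Normal] {n : G} (hn : n ∈ N) :
    MulAut.conj n ∈ autTrivialOnQuotient N := fun g ↦ by
  have := N.mul_mem (hN.conj_mem n hn g⁻¹) (N.inv_mem hn)
  simpa [mul_assoc] using this

theorem finiteIndex_autTrivialOnQuotient (hG : Group.FG G) [N.Normal] [N.FiniteIndex] :
    (autTrivialOnQuotient N).FiniteIndex := by
  have : Finite (G →* G ⧸ N) := hG.finite_monoidHom
  rw [Subgroup.finiteIndex_iff_finite_quotient]
  let f (α : MulAut G) : G →* G ⧸ N := (QuotientGroup.mk' N).comp α⁻¹.toMonoidHom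
  refine Finite.of_injective
    (fun x : MulAut G ⧸ autTrivialOnQuotient N ↦ f x.out) fun x y hxy ↦ ?_
  rw [← x.out_eq', ← y.out_eq']
  refine QuotientGroup.eq.mpr fun g ↦ ?_
  have h : ((y.out⁻¹ (y.out g) : G) : G ⧸ N) = (x.out⁻¹ (y.out g) : G) :=
    (DFunLike.congr_fun hxy (y.out g)).symm
  simpa using QuotientGroup.eq.mp h

variable (N)

/-- Restriction to `N` of the automorphisms preserving every left coset of `N`. -/
def restrictAut : autTrivialOnQuotient N →* MulAut N where
  toFun α :=
    { toFun n := ⟨α.1 n, map_mem_of_mem_autTrivialOnQuotient α.2 n.2⟩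
      invFun n := ⟨α.1⁻¹ n, map_mem_of_mem_autTrivialOnQuotient (inv_mem α.2) n.2⟩
      left_inv n := by simp
      right_inv n := by simp
      map_mul' m n := by simp }
  map_one' := rfl
  map_mul' _ _ := rfl

@[simp]
theorem coe_restrictAut_apply (α : autTrivialOnQuotient N) (n : N) :
    (restrictAut N α n : G) = α.1 n := rfl

variable {N}

theorem restrictAut_injective [hN : N.Normal] (hcl : Subgroup.center N = ⊥) :
    Function.Injective (restrictAut N) := by
  rw [injective_iff_map_eq_one]
  intro α hα
  have hfix (n : G) (hn : n ∈ N) : α.1 n = n := by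
    simpa using congrArg Subtype.val (DFunLike.congr_fun hα ⟨n, hn⟩)
  ext g
  have hc : (⟨g⁻¹ * α.1 g, α.2 g⟩ : N) ∈ Subgroup.center N := by
    refine Subgroup.mem_center_iff.mpr fun n ↦ Subtype.ext ?_
    have h := hfix _ (hN.conj_mem n n.2 g)
    simp only [map_mul, map_inv, hfix n n.2] at h
    change (n : G) * (g⁻¹ * α.1 g) = g⁻¹ * α.1 g * n
    rw [mul_inv_eq_iff_eq_mul] at h
    rw [mul_assoc g⁻¹, h]
    group
  rw [hcl, Subgroup.mem_bot, Subtype.ext_iff] at hc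
  exact (inv_mul_eq_one.mp hc).symm

theorem restrictAut_conj [N.Normal] (n : N) :
    restrictAut N ⟨MulAut.conj (n : G), conj_mem_autTrivialOnQuotient n.2⟩ = MulAut.conj n := by
  ext; simp

variable (N)

/-- The outer automorphism of `N` induced by an automorphism preserving every left coset of `N`. -/
def restrictOut : autTrivialOnQuotient N →* Out N :=
  (QuotientGroup.mk' _).comp (restrictAut N)

variable {N}

theorem exists_conj_eq_of_restrictOut_eq_one [N.Normal] (hcl : Subgroup.center N = ⊥)
    {α : autTrivialOnQuotient N}
    (hα : restrictOut N α = 1) : ∃ n : N, MulAut.conj (n : G) = α := by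
  obtain ⟨n, hn⟩ := (QuotientGroup.eq_one_iff _).mp hα
  have h := restrictAut_injective hcl ((restrictAut_conj n).trans hn)
  exact ⟨n, congrArg Subtype.val h⟩

theorem finite_range_restrictOut_conj [N.Normal] [N.FiniteIndex] :
    Finite ((restrictOut N).comp
      ((MulAut.conj : G →* MulAut G).subgroupComap (autTrivialOnQuotient N))).range := by
  set φ := (restrictOut N).comp
    ((MulAut.conj : G →* MulAut G).subgroupComap (autTrivialOnQuotient N))
  have hle : N.subgroupOf ((autTrivialOnQuotient N).comap MulAut.conj) ≤ φ.ker := by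
    intro b hb
    exact (QuotientGroup.eq_one_iff _).mpr ⟨⟨b, hb⟩, (restrictAut_conj _).symm⟩
  have : φ.ker.FiniteIndex := Subgroup.finiteIndex_of_le hle
  exact Finite.of_equiv _ (QuotientGroup.quotientKerEquivRange φ).toEquiv

theorem exists_mulEquiv_quotient [N.Normal] [N.FiniteIndex] (hcl : Subgroup.center N = ⊥) :
    ∃ (S : Subgroup (Out N)) (F : Subgroup S) (_ : F.Normal) (_ : Finite F),
      Nonempty ((autTrivialOnQuotient N).map
        (QuotientGroup.mk' (MulAut.conj : G →* MulAut G).range) ≃* S ⧸ F) := by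
  let mk := QuotientGroup.mk' (MulAut.conj : G →* MulAut G).range
  let π := mk.subgroupMap (autTrivialOnQuotient N)
  have hπ : Function.Surjective π := mk.subgroupMap_surjective _
  let p := (restrictOut N).rangeRestrict
  have hp : Function.Surjective p := (restrictOut N).rangeRestrict_surjective
  have hker : p.ker ≤ π.ker := by
    intro α hα
    obtain ⟨n, hn⟩ := exists_conj_eq_of_restrictOut_eq_one hcl (congrArg Subtype.val hα)
    exact Subtype.ext ((QuotientGroup.eq_one_iff _).mpr ⟨n, hn⟩)
  let q := p.liftOfSurjective hp ⟨π, hker⟩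
  have hq (α) : q (p α) = π α := MonoidHom.liftOfRightInverse_comp_apply _ _ _ ⟨π, hker⟩ α
  have hqs : Function.Surjective q := fun y ↦ by
    obtain ⟨α, rfl⟩ := hπ y
    exact ⟨p α, hq α⟩
  refine ⟨_, q.ker, inferInstance, ?_,
    ⟨(QuotientGroup.quotientKerEquivOfSurjective q hqs).symm⟩⟩
  have := finite_range_restrictOut_conj (N := N)
  have hmem (s : q.ker) : s.1.1 ∈ ((restrictOut N).comp
      ((MulAut.conj : G →* MulAut G).subgroupComap (autTrivialOnQuotient N))).range := by
    obtain ⟨s, hs⟩ := s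
    obtain ⟨α, rfl⟩ := hp s
    rw [MonoidHom.mem_ker, hq] at hs
    obtain ⟨g, hg⟩ := (QuotientGroup.eq_one_iff _).mp (congrArg Subtype.val hs)
    exact ⟨⟨g, Subgroup.mem_comap.mpr (hg ▸ α.2)⟩, congrArg (restrictOut N) (Subtype.ext hg)⟩
  exact Finite.of_injective (fun s ↦ (⟨s.1.1, hmem s⟩ : MonoidHom.range _))
    fun s t hst ↦ Subtype.ext (Subtype.ext (Subtype.ext_iff.mp hst :))

end TrivialOnQuotient

/-- If `G` is finitely generated and `N ⊴ G` is a centerless normal subgroup of finite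
index, then the finite index subgroup `Out₀(G) ≤ Out(G)` of classes of automorphisms
preserving `N` and acting trivially on `G/N` (i.e. with `g⁻¹α(g) ∈ N` for all `g`) is
isomorphic to the quotient of a subgroup of `Out(N)` by a finite normal subgroup.
Consequently, if `Out(N)` is residually finite then so is `Out(G)`. -/
theorem stmt10 (G : Type*) [Group G] (hfg : Group.FG G)
    (N : Subgroup G) [N.Normal] [N.FiniteIndex]
    (hcl : Subgroup.center N = ⊥) :
    (∃ A₀ : Subgroup (MulAut G),
      ((A₀ : Set (MulAut G)) = {α : MulAut G | ∀ g : G, g⁻¹ * α g ∈ N}) ∧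
      ∃ Out₀ : Subgroup (Out G),
        Out₀ = A₀.map (QuotientGroup.mk' (MulAut.conj : G →* MulAut G).range) ∧
        Out₀.FiniteIndex ∧
        ∃ (S : Subgroup (Out N)) (F : Subgroup S) (hF : F.Normal) (_ : Finite F),
          Nonempty (Out₀ ≃* S ⧸ F)) ∧
    (ResiduallyFinite (Out N) → ResiduallyFinite (Out G)) := by
  have := finiteIndex_autTrivialOnQuotient (N := N) hfg
  have hfin : ((autTrivialOnQuotient N).map
      (QuotientGroup.mk' (MulAut.conj : G →* MulAut G).range)).FiniteIndex :=
    ⟨ne_zero_of_dvd_ne_zero this.index_ne_zero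
      (Subgroup.index_map_dvd _ (QuotientGroup.mk'_surjective _))⟩
  obtain ⟨S, F, hF, hFfin, ⟨e⟩⟩ := exists_mulEquiv_quotient hcl
  refine ⟨⟨_, rfl, _, rfl, hfin, S, F, hF, hFfin, ⟨e⟩⟩, fun h ↦ ?_⟩
  exact .of_finiteIndex _ (.of_injective e.toMonoidHom e.injective
    ((h.of_injective S.subtype S.subtype_injective).quotient F))
end

section
/- Let H be a finitely generated residually p-finite group, for a prime p. Then Aut_p(H), the group of automorphisms of H acting trivially on H/([H,H]H^p), is residually p-finite; consequently Aut(H) is virtually residually p-finite. -/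
variable (p : ℕ) (H : Type*) [Group H]

/-- The verbal subgroup `K_p = [H,H]Hᵖ` generated by all commutators and all `p`-th
powers; the quotient `H/K_p` is the first mod-`p` homology of `H`. -/
def Kp : Subgroup H := commutator H ⊔ Subgroup.closure {x : H | ∃ g : H, g ^ p = x}

lemma Kp_map_le (α : MulAut H) : (Kp p H).map α.toMonoidHom ≤ Kp p H := by
  rw [Kp, Subgroup.map_sup]
  apply sup_le
  · refine le_trans (Subgroup.characteristic_iff_map_le.mp inferInstance α) le_sup_left
  · rw [MonoidHom.map_closure]
    refine le_trans (Subgroup.closure_mono ?_) le_sup_right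
    rintro x ⟨y, ⟨g, hg⟩, rfl⟩
    exact ⟨α g, by rw [← map_pow]; exact congrArg _ hg⟩

/-- The subgroup `Aut_p(H) ≤ Aut(H)` of automorphisms acting trivially on
`H / [H,H]Hᵖ`. -/
def AutP : Subgroup (MulAut H) where
  carrier := {α : MulAut H | ∀ h : H, h⁻¹ * α h ∈ Kp p H}
  one_mem' := by intro h; simpa using (Kp p H).one_mem
  mul_mem' := by
    intro α β hα hβ h
    have h1 : (h⁻¹ * α h) * (α (h⁻¹ * β h)) ∈ Kp p H := by
      refine mul_mem (hα h) (Kp_map_le p H α ⟨_, hβ h, rfl⟩)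
    simpa [map_mul, mul_assoc] using h1
  inv_mem' := by
    intro α hα h
    have h1 := hα (α⁻¹ h)
    have h2 : ((α⁻¹ h)⁻¹ * h)⁻¹ ∈ Kp p H := by
      refine inv_mem ?_
      simpa using h1
    simpa [mul_inv_rev] using h2

/-- A group is residually `p`-finite if every nontrivial element has nontrivial image
in some finite `p`-group quotient. -/
def ResiduallyPFinite (q : ℕ) (G : Type*) [Group G] : Prop :=
  ∀ g : G, g ≠ 1 →
    ∃ (K : Type) (_ : Group K) (_ : Finite K), IsPGroup q K ∧ ∃ φ : G →* K, φ g ≠ 1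

lemma Kp_map_hom_le {G G' : Type*} [Group G] [Group G'] (f : G →* G') :
    (Kp p G).map f ≤ Kp p G' := by
  rw [Kp, Subgroup.map_sup]
  refine sup_le (le_trans ?_ le_sup_left) (le_trans ?_ le_sup_right)
  · rw [commutator_def, Subgroup.map_commutator]
    exact Subgroup.commutator_mono le_top le_top
  · rw [MonoidHom.map_closure]
    refine Subgroup.closure_mono ?_
    rintro x ⟨y, ⟨g, rfl⟩, rfl⟩
    exact ⟨f g, (map_pow f g p).symm⟩

instance Kp_characteristic : (Kp p H).Characteristic :=
  Subgroup.characteristic_iff_map_le.mpr fun α => Kp_map_hom_le p α.toMonoidHom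

/-- The action of `Aut(G)` on the quotient of `G` by a characteristic subgroup. -/
noncomputable def mulAutQuotient {G : Type*} [Group G] (C : Subgroup G) [hC : C.Characteristic] :
    MulAut G →* MulAut (G ⧸ C) where
  toFun α := QuotientGroup.congr C C α (Subgroup.characteristic_iff_map_eq.mp hC α)
  map_one' := by
    ext x
    induction x using QuotientGroup.induction_on with
    | H x => rfl
  map_mul' α β := by
    ext x
    induction x using QuotientGroup.induction_on with
    | H x => rfl

lemma mulAutQuotient_mk {G : Type*} [Group G] (C : Subgroup G) [C.Characteristic]
    (α : MulAut G) (x : G) : mulAutQuotient C α (x : G ⧸ C) = (α x : G) := rfl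

lemma mulAutQuotient_mem_AutP {G : Type*} [Group G] (C : Subgroup G) [C.Characteristic]
    {α : MulAut G} (hα : α ∈ AutP p G) : mulAutQuotient C α ∈ AutP p (G ⧸ C) := by
  intro x
  induction x using QuotientGroup.induction_on with
  | H x => exact Kp_map_hom_le p (QuotientGroup.mk' C) ⟨_, hα x, rfl⟩

lemma ker_mulAutQuotient_Kp_le : (mulAutQuotient (Kp p H)).ker ≤ AutP p H := by
  intro α hα h
  have h1 : mulAutQuotient (Kp p H) α (h : H ⧸ Kp p H) = h := by
    rw [MonoidHom.mem_ker.mp hα]; rfl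
  rw [mulAutQuotient_mk] at h1
  exact QuotientGroup.eq.mp h1.symm

lemma finite_quotient_Kp (hp : p ≠ 0) [Group.FG H] : Finite (H ⧸ Kp p H) := by
  let _ : CommGroup (H ⧸ Kp p H) :=
    { (inferInstance : Group (H ⧸ Kp p H)) with
      mul_comm := by
        intro a b
        induction a using QuotientGroup.induction_on with | H a => ?_
        induction b using QuotientGroup.induction_on with | H b => ?_
        refine QuotientGroup.eq.mpr (le_sup_left (a := commutator H) ?_)
        have := Subgroup.commutator_mem_commutator (Subgroup.mem_top b⁻¹) (Subgroup.mem_top a⁻¹)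
        simpa [commutator_def, commutatorElement_def, mul_assoc] using this }
  refine CommGroup.finite_of_fg_isMulTorsion _ fun a => ?_
  rw [isOfFinOrder_iff_pow_eq_one]
  refine ⟨p, Nat.pos_of_ne_zero hp, ?_⟩
  induction a using QuotientGroup.induction_on with | H a => ?_
  exact (QuotientGroup.eq_one_iff _).mpr
    (le_sup_right (a := commutator H) (Subgroup.subset_closure ⟨a, rfl⟩))

lemma finiteIndex_AutP (hp : p ≠ 0) [Group.FG H] : (AutP p H).FiniteIndex := by
  have := finite_quotient_Kp p H hp
  exact Subgroup.finiteIndex_of_le (ker_mulAutQuotient_Kp_le p H)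

lemma isSimpleGroup_quotient_of_isCoatom {G : Type*} [Group G] {M : Subgroup G} [M.Normal]
    (hM : IsCoatom M) : IsSimpleGroup (G ⧸ M) where
  toNontrivial := QuotientGroup.nontrivial_iff.mpr hM.1
  eq_bot_or_eq_top_of_normal N _ := by
    have hle : M ≤ N.comap (QuotientGroup.mk' M) := QuotientGroup.le_comap_mk' M N
    have hinj := Subgroup.comap_injective (QuotientGroup.mk'_surjective M)
    rcases hM.le_iff.mp hle with h | h
    · exact Or.inr (hinj (by simpa using h))
    · exact Or.inl (hinj (by simpa using h))

lemma Kp_le_frattini {Q : Type*} [Group Q] [Finite Q] [Fact p.Prime] (hQ : IsPGroup p Q) :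
    Kp p Q ≤ frattini Q := by
  have hnil := hQ.isNilpotent
  rw [frattini, Order.radical]
  refine le_iInf₂ fun M (hM : IsCoatom M) => ?_
  have hN : M.Normal :=
    Subgroup.NormalizerCondition.normal_of_coatom M Group.normalizerCondition_of_isNilpotent hM
  have hs := isSimpleGroup_quotient_of_isCoatom hM
  have hcomm : ∀ a b : Q ⧸ M, a * b = b * a := IsSimpleGroup.comm_iff_isSolvable.mpr inferInstance
  have hcard : Nat.card (Q ⧸ M) = p := by
    let _ : CommGroup (Q ⧸ M) := { (inferInstance : Group (Q ⧸ M)) with mul_comm := hcomm }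
    have h1 : (Nat.card (Q ⧸ M)).Prime := IsSimpleGroup.prime_card
    obtain ⟨n, hn⟩ := IsPGroup.iff_card.mp (hQ.to_quotient M)
    rw [hn] at h1 ⊢
    rw [(Nat.Prime.eq_one_of_pow h1), pow_one]
  refine sup_le ?_ ((Subgroup.closure_le _).mpr ?_)
  · rw [commutator_def, Subgroup.commutator_le]
    intro a _ b _
    rw [← QuotientGroup.eq_one_iff, ← QuotientGroup.mk'_apply, map_commutatorElement,
      commutatorElement_eq_one_iff_mul_comm]
    exact hcomm _ _
  · rintro _ ⟨g, rfl⟩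
    refine (QuotientGroup.eq_one_iff _).mp ?_
    rw [QuotientGroup.mk_pow, ← hcard, pow_card_eq_one']

/-- Theorem of P. Hall: for a finite `p`-group `Q`, the group `Aut_p(Q)` is a `p`-group. -/
lemma isPGroup_AutP {Q : Type*} [Group Q] [Finite Q] [Fact p.Prime] (hQ : IsPGroup p Q) :
    IsPGroup p (AutP p Q) := by
  rw [isPGroup_iff_primeFactors_card_subset (Fact.out : p.Prime).ne_zero]
  intro q hq
  have hqp := Nat.prime_of_mem_primeFactors hq
  have := Fact.mk hqp
  rw [(Fact.out : p.Prime).primeFactors, Finset.mem_singleton]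
  by_contra hne
  obtain ⟨β, hβ⟩ := exists_prime_orderOf_dvd_card' q (Nat.dvd_of_mem_primeFactors hq)
  let F : Subgroup Q :=
    { carrier := {y | β.1 y = y}
      one_mem' := map_one _
      mul_mem' := fun {a b} (ha : _ = _) (hb : _ = _) => by
        change β.1 (a * b) = a * b
        rw [map_mul, ha, hb]
      inv_mem' := fun {a} (ha : _ = _) => by
        change β.1 a⁻¹ = a⁻¹
        rw [map_inv, ha] }
  have hfix : ∀ x : Q, ∃ y ∈ F, x⁻¹ * y ∈ Kp p Q := by
    intro x
    let S : SubMulAction (Subgroup.zpowers β) Q :=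
      { carrier := {y | x⁻¹ * y ∈ Kp p Q}
        smul_mem' := fun c {y} (hy : _ ∈ _) => by
          change x⁻¹ * c.1.1 y ∈ Kp p Q
          have := mul_mem hy (c.1.2 y)
          simpa [mul_assoc] using this }
    have hcard : Nat.card S = Nat.card (Kp p Q) :=
      Nat.card_congr
        { toFun := fun y => ⟨x⁻¹ * y.1, y.2⟩
          invFun := fun k => ⟨x * k.1, by
            change x⁻¹ * (x * k.1) ∈ Kp p Q
            simp⟩
          left_inv := fun y => by simp
          right_inv := fun k => by simp }
    have hz : IsPGroup q (Subgroup.zpowers β) :=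
      IsPGroup.of_card (n := 1) (by rw [Nat.card_zpowers, hβ, pow_one])
    obtain ⟨y, hy⟩ := hz.nonempty_fixed_point_of_prime_not_dvd_card S (by
      obtain ⟨n, hn⟩ := IsPGroup.iff_card.mp (hQ.to_subgroup (Kp p Q))
      rw [hcard, hn]
      exact fun h => hne ((Nat.prime_dvd_prime_iff_eq hqp Fact.out).mp (hqp.dvd_of_dvd_pow h)))
    exact ⟨y, congrArg Subtype.val (hy ⟨β, Subgroup.mem_zpowers β⟩), y.2⟩
  have hF : F = ⊤ := by
    refine frattini_nongenerating (eq_top_iff.mpr fun x _ => ?_)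
    obtain ⟨y, hyF, hy⟩ := hfix x
    have := mul_mem (Subgroup.mem_sup_left (T := frattini Q) hyF)
      (Subgroup.mem_sup_right (S := F) (inv_mem (Kp_le_frattini p hQ hy)))
    simpa using this
  have hβ1 : β = 1 := by
    ext y
    exact (hF ▸ Subgroup.mem_top y : y ∈ F)
  rw [hβ1, orderOf_one] at hβ
  exact hqp.one_lt.ne hβ

lemma MonoidHom.finite_of_fg (G K : Type*) [Group G] [Group K] [hG : Group.FG G] [Finite K] :
    Finite (G →* K) := by
  obtain ⟨S, hS⟩ := hG.out
  refine Finite.of_injective (fun (f : G →* K) (s : S) => f s) fun f g hfg => ?_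
  exact MonoidHom.eq_of_eqOn_dense hS fun s hs => congrFun hfg ⟨s, hs⟩

/-- The product of all homomorphisms from `G` to `K`. -/
def piHom (G K : Type*) [Group G] [Group K] : G →* ((G →* K) → K) :=
  MonoidHom.pi fun f => f

instance piHom_ker_characteristic (G K : Type*) [Group G] [Group K] :
    (piHom G K).ker.Characteristic := by
  refine Subgroup.characteristic_iff_le_comap.mpr fun α x hx => ?_
  rw [Subgroup.mem_comap, MonoidHom.mem_ker]
  funext f
  exact congrFun (MonoidHom.mem_ker.mp hx) (f.comp α.toMonoidHom)

lemma IsPGroup.pi {ι K : Type*} [Group K] [Finite K] (hK : IsPGroup p K) :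
    IsPGroup p (ι → K) := by
  obtain ⟨n, hn⟩ := isPGroup_iff_card_dvd_pow.mp hK
  refine fun g => ⟨n, funext fun i => ?_⟩
  exact orderOf_dvd_iff_pow_eq_one.mp ((orderOf_dvd_natCard (g i)).trans hn)

lemma residuallyPFinite_AutP (hp : p.Prime) [Group.FG H] (hrf : ResiduallyPFinite p H) :
    ResiduallyPFinite p (AutP p H) := by
  intro α hα
  have := Fact.mk hp
  obtain ⟨h, hh⟩ : ∃ h, α.1 h ≠ h := by
    by_contra! hc
    exact hα (Subtype.ext (MulEquiv.ext hc))
  obtain ⟨K, _, _, hK, φ, hφ⟩ := hrf (h⁻¹ * α.1 h) (by rwa [ne_eq, inv_mul_eq_one, eq_comm])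
  have := MonoidHom.finite_of_fg H K
  let C := (piHom H K).ker
  have hCfin : Finite (H ⧸ C) := .of_injective _ (QuotientGroup.kerLift_injective (piHom H K))
  have hCp : IsPGroup p (H ⧸ C) :=
    (IsPGroup.pi p hK).of_injective _ (QuotientGroup.kerLift_injective (piHom H K))
  let ψ : AutP p H →* AutP p (H ⧸ C) :=
    ((mulAutQuotient C).comp (AutP p H).subtype).codRestrict _
      fun α => mulAutQuotient_mem_AutP p C α.2
  obtain ⟨G', _, _, ⟨e⟩⟩ := Finite.exists_type_univ_nonempty_mulEquiv (AutP p (H ⧸ C))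
  refine ⟨G', _, inferInstance, (isPGroup_AutP p hCp).of_equiv e, e.toMonoidHom.comp ψ, fun h1 => ?_⟩
  have h2 : ψ α = 1 := e.injective (h1.trans (map_one e).symm)
  have h3 : ((α.1 h : H) : H ⧸ C) = h := congrArg (fun γ : AutP p (H ⧸ C) => γ.1 (h : H ⧸ C)) h2
  have h4 : h⁻¹ * α.1 h ∈ C := QuotientGroup.eq.mp h3.symm
  exact hφ (congrFun (MonoidHom.mem_ker.mp h4) φ)

/-- If `H` is a finitely generated residually `p`-finite group, then `Aut_p(H)` (the
finite index subgroup of `Aut(H)` of automorphisms acting trivially on `H/([H,H]Hᵖ)`)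
is residually `p`-finite; consequently `Aut(H)` is virtually residually `p`-finite. -/
theorem stmt14 (hp : p.Prime) (hfg : Group.FG H) (hrf : ResiduallyPFinite p H) :
    (ResiduallyPFinite p (AutP p H) ∧ (AutP p H).FiniteIndex) ∧
    ∃ U : Subgroup (MulAut H), U.FiniteIndex ∧ ResiduallyPFinite p U := by
  have := hfg
  have hres := residuallyPFinite_AutP p H hp hrf
  have hfin := finiteIndex_AutP p H hp.ne_zero
  exact ⟨⟨hres, hfin⟩, _, hfin, hres⟩
end
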